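/- arXiv:1706.07607 — 2 statements merged into one kernel-verified Lean document; each statement's English description precedes it below -/
import Mathlib

section
/- Let f : ℕ → ℝ satisfy f(k) > 0 for all k ≥ 1, and suppose λ* > 0 satisfies ρ_f(λ*) = 1. With p_k = (λ*/(λ* + f(k))) ∏_{j=1}^{k−1} f(j)/(λ* + f(j)), for every k ≥ 1 one has f(k)/(∑_{j=1}^∞ p_j f(j)) = (∑_{j=k+1}^∞ p_j)/p_k. -/
open scoped ENNReal

/-- `ρ_f(λ) = ∑_{l=1}^∞ ∏_{k=1}^l f(k)/(λ + f(k))`, as an element of `[0,∞]`. -/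
noncomputable def rhoPA (f : ℕ → ℝ) (lam : ℝ) : ℝ≥0∞ :=
  ∑' l : ℕ, ENNReal.ofReal (∏ k ∈ Finset.Icc 1 (l + 1), f k / (lam + f k))

/-- The limiting degree distribution
`p_k = (λ*/(λ* + f(k))) ∏_{j=1}^{k−1} f(j)/(λ* + f(j))`. -/
noncomputable def pPA (f : ℕ → ℝ) (lam : ℝ) (k : ℕ) : ℝ :=
  (lam / (lam + f k)) * ∏ j ∈ Finset.Icc 1 (k - 1), f j / (lam + f j)

/-- The product `∏_{k=1}^n f(k)/(λ + f(k))`. -/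
noncomputable def prodPA (f : ℕ → ℝ) (lam : ℝ) (n : ℕ) : ℝ :=
  ∏ k ∈ Finset.Icc 1 n, f k / (lam + f k)

lemma prodPA_succ (f : ℕ → ℝ) (lam : ℝ) (n : ℕ) :
    prodPA f lam (n + 1) = prodPA f lam n * (f (n + 1) / (lam + f (n + 1))) :=
  Finset.prod_Icc_succ_top (by omega) _

lemma prodPA_pos {f : ℕ → ℝ} (hf : ∀ k, 1 ≤ k → 0 < f k) {lam : ℝ} (hlam : 0 < lam) (n : ℕ) :
    0 < prodPA f lam n :=
  Finset.prod_pos fun k hk => by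
    have := hf k (Finset.mem_Icc.mp hk).1
    positivity

lemma pPA_succ_eq_sub {f : ℕ → ℝ} (hf : ∀ k, 1 ≤ k → 0 < f k) {lam : ℝ} (hlam : 0 < lam)
    (n : ℕ) : pPA f lam (n + 1) = prodPA f lam n - prodPA f lam (n + 1) := by
  have h := hf (n + 1) (by omega)
  have h' : lam + f (n + 1) ≠ 0 := by positivity
  rw [prodPA_succ, pPA, Nat.add_sub_cancel, ← prodPA]
  field_simp
  ring

lemma pPA_succ_mul (f : ℕ → ℝ) (lam : ℝ) (n : ℕ) :
    pPA f lam (n + 1) * f (n + 1) = lam * prodPA f lam (n + 1) := by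
  rw [prodPA_succ, pPA, Nat.add_sub_cancel, ← prodPA]
  ring

lemma hasSum_prodPA_succ {f : ℕ → ℝ} (hf : ∀ k, 1 ≤ k → 0 < f k) {lam : ℝ} (hlam : 0 < lam)
    (h : rhoPA f lam = 1) : HasSum (fun n => prodPA f lam (n + 1)) 1 := by
  have hnn : ∀ n, 0 ≤ prodPA f lam (n + 1) := fun n => (prodPA_pos hf hlam _).le
  have h1 : ∑' n, ENNReal.ofReal (prodPA f lam (n + 1)) = 1 := h
  have hs := ENNReal.hasSum_toReal (h1.trans_ne ENNReal.one_ne_top)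
  rw [← ENNReal.tsum_toReal_eq fun _ => ENNReal.ofReal_ne_top, h1, ENNReal.toReal_one] at hs
  simpa only [ENNReal.toReal_ofReal (hnn _)] using hs

lemma hasSum_pPA_tail {f : ℕ → ℝ} (hf : ∀ k, 1 ≤ k → 0 < f k) {lam : ℝ} (hlam : 0 < lam)
    (h : rhoPA f lam = 1) (k : ℕ) :
    HasSum (fun j => pPA f lam (k + 1 + j)) (prodPA f lam k) := by
  have hterm : ∀ j, pPA f lam (k + 1 + j) = prodPA f lam (k + j) - prodPA f lam (k + (j + 1)) := by
    intro j
    rw [add_right_comm k 1 j, pPA_succ_eq_sub hf hlam, add_assoc]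
  have hnn : ∀ j, 0 ≤ pPA f lam (k + 1 + j) := fun j => by
    have := hf (k + 1 + j) (by omega)
    have := prodPA_pos hf hlam (k + 1 + j - 1)
    rw [pPA, ← prodPA]
    positivity
  rw [hasSum_iff_tendsto_nat_of_nonneg hnn]
  simp only [hterm, Finset.sum_range_sub' (fun j => prodPA f lam (k + j)), add_zero]
  have hlim : Filter.Tendsto (prodPA f lam) Filter.atTop (nhds 0) :=
    (Filter.tendsto_add_atTop_iff_nat 1).mp
      (hasSum_prodPA_succ hf hlam h).summable.tendsto_atTop_zero
  have hshift : Filter.Tendsto (fun j => prodPA f lam (k + j)) Filter.atTop (nhds 0) := by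
    simpa only [add_comm k] using (Filter.tendsto_add_atTop_iff_nat k).mpr hlim
  simpa using hshift.const_sub (prodPA f lam k)

/-- If `λ* > 0` satisfies `ρ_f(λ*) = 1`, then for every `k ≥ 1` one has
`f(k)/(∑_{j=1}^∞ p_j f(j)) = (∑_{j=k+1}^∞ p_j)/p_k`. -/
theorem pPA_ratio_identity (f : ℕ → ℝ) (hf : ∀ k, 1 ≤ k → 0 < f k)
    (lam : ℝ) (hlam : 0 < lam) (hmalthus : rhoPA f lam = 1) (k : ℕ) (hk : 1 ≤ k) :
    f k / (∑' j : ℕ, pPA f lam (j + 1) * f (j + 1)) =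
      (∑' j : ℕ, pPA f lam (k + 1 + j)) / pPA f lam k := by
  have hmean : ∑' j : ℕ, pPA f lam (j + 1) * f (j + 1) = lam := by
    simp only [pPA_succ_mul]
    simpa using ((hasSum_prodPA_succ hf hlam hmalthus).mul_left lam).tsum_eq
  rw [hmean, (hasSum_pPA_tail hf hlam hmalthus k).tsum_eq]
  obtain ⟨n, rfl⟩ := Nat.exists_eq_add_of_le' hk
  have hmul := pPA_succ_mul f lam n
  have hp : pPA f lam (n + 1) ≠ 0 := by
    intro h0
    rw [h0, zero_mul] at hmul
    exact (mul_pos hlam (prodPA_pos hf hlam (n + 1))).ne hmul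
  rw [div_eq_div_iff hlam.ne' hp]
  linarith
end

section
/- Let f : ℕ → ℝ satisfy f(k) > 0 for all k ≥ 1, and suppose there exists λ₀ > 0 with 1 < ρ_f(λ₀) < ∞. Then there exists a unique λ* ∈ [λ₀, ∞) with ρ_f(λ*) = 1 (the Malthusian parameter). -/
open scoped ENNReal

open Filter Topology Set

section PreferentialAttachment

variable {f : ℕ → ℝ}

lemma prod_div_add_pos (hf : ∀ k, 1 ≤ k → 0 < f k) {x : ℝ} (hx : 0 < x) (n : ℕ) :
    0 < ∏ k ∈ Finset.Icc 1 n, f k / (x + f k) :=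
  Finset.prod_pos fun k hk => by
    have := hf k (Finset.mem_Icc.1 hk).1
    positivity

lemma prod_div_add_strictAntiOn (hf : ∀ k, 1 ≤ k → 0 < f k) (l : ℕ) :
    StrictAntiOn (fun x : ℝ => ∏ k ∈ Finset.Icc 1 (l + 1), f k / (x + f k)) (Ioi 0) := by
  intro x hx y hy hxy
  rw [mem_Ioi] at hx hy
  refine Finset.prod_lt_prod_of_nonempty (fun k hk => ?_) (fun k hk => ?_) (by simp)
  all_goals have := hf k (Finset.mem_Icc.1 hk).1
  · positivity
  · gcongr

lemma continuousOn_prod_div_add (hf : ∀ k, 1 ≤ k → 0 < f k) (n : ℕ) :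
    ContinuousOn (fun x : ℝ => ∏ k ∈ Finset.Icc 1 n, f k / (x + f k)) (Ioi 0) :=
  continuousOn_finsetProd _ fun k hk =>
    continuousOn_const.div (by fun_prop) fun x hx =>
      (add_pos hx (hf k (Finset.mem_Icc.1 hk).1)).ne'

lemma tendsto_prod_div_add_atTop (l : ℕ) :
    Tendsto (fun x : ℝ => ∏ k ∈ Finset.Icc 1 (l + 1), f k / (x + f k)) atTop (𝓝 0) := by
  have h := tendsto_finsetProd (Finset.Icc 1 (l + 1)) fun k _ =>
    (tendsto_atTop_add_const_right atTop (f k) tendsto_id).const_div_atTop (f k)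
  simpa using h

lemma rhoPA_eq_ofReal_tsum (hf : ∀ k, 1 ≤ k → 0 < f k) {x : ℝ} (hx : 0 < x)
    (hs : Summable fun l : ℕ => ∏ k ∈ Finset.Icc 1 (l + 1), f k / (x + f k)) :
    rhoPA f x = ENNReal.ofReal (∑' l : ℕ, ∏ k ∈ Finset.Icc 1 (l + 1), f k / (x + f k)) :=
  (ENNReal.ofReal_tsum_of_nonneg (fun l => (prod_div_add_pos hf hx (l + 1)).le) hs).symm

lemma summable_of_rhoPA_lt_top (hf : ∀ k, 1 ≤ k → 0 < f k) {x : ℝ} (hx : 0 < x)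
    (h : rhoPA f x < ⊤) :
    Summable fun l : ℕ => ∏ k ∈ Finset.Icc 1 (l + 1), f k / (x + f k) := by
  refine (ENNReal.summable_toReal h.ne).congr fun l => ?_
  exact ENNReal.toReal_ofReal (prod_div_add_pos hf hx (l + 1)).le

end PreferentialAttachment

/-- If `1 < ρ_f(λ₀) < ∞` for some `λ₀ > 0`, then there exists a unique `λ* ∈ [λ₀, ∞)`
with `ρ_f(λ*) = 1` (the Malthusian parameter). -/
theorem existsUnique_malthusian (f : ℕ → ℝ) (hf : ∀ k, 1 ≤ k → 0 < f k)
    (lam₀ : ℝ) (h₀ : 0 < lam₀) (h₁ : 1 < rhoPA f lam₀) (h₂ : rhoPA f lam₀ < ⊤) :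
    ∃! lam : ℝ, lam₀ ≤ lam ∧ rhoPA f lam = 1 := by
  set p : ℕ → ℝ → ℝ := fun l x => ∏ k ∈ Finset.Icc 1 (l + 1), f k / (x + f k)
  have pos {x : ℝ} (hx : lam₀ ≤ x) : 0 < x := h₀.trans_le hx
  have nonneg (l : ℕ) {x : ℝ} (hx : lam₀ ≤ x) : 0 ≤ p l x :=
    (prod_div_add_pos hf (pos hx) (l + 1)).le
  have le_init (l : ℕ) {x : ℝ} (hx : lam₀ ≤ x) : p l x ≤ p l lam₀ :=
    (prod_div_add_strictAntiOn hf l).antitoneOn h₀ (pos hx) hx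
  have hs₀ : Summable fun l => p l lam₀ := summable_of_rhoPA_lt_top hf h₀ h₂
  have hs {x : ℝ} (hx : lam₀ ≤ x) : Summable fun l => p l x :=
    hs₀.of_nonneg_of_le (fun l => nonneg l hx) fun l => le_init l hx
  have rho_eq {x : ℝ} (hx : lam₀ ≤ x) : rhoPA f x = ENNReal.ofReal (∑' l, p l x) :=
    rhoPA_eq_ofReal_tsum hf (pos hx) (hs hx)
  have anti : StrictAntiOn (fun x => ∑' l, p l x) (Ici lam₀) := fun x hx y hy hxy =>
    Summable.tsum_lt_tsum (i := 0)
      (fun l => (prod_div_add_strictAntiOn hf l (pos hx) (pos hy) hxy).le)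
      (prod_div_add_strictAntiOn hf 0 (pos hx) (pos hy) hxy) (hs hy) (hs hx)
  have norm_le (l : ℕ) (x : ℝ) (hx : lam₀ ≤ x) : ‖p l x‖ ≤ p l lam₀ := by
    rw [Real.norm_of_nonneg (nonneg l hx)]
    exact le_init l hx
  have cont : ContinuousOn (fun x => ∑' l, p l x) (Ici lam₀) :=
    continuousOn_tsum (fun l => (continuousOn_prod_div_add hf (l + 1)).mono fun x hx => pos hx)
      hs₀ fun l x hx => norm_le l x hx
  have lim : Tendsto (fun x => ∑' l, p l x) atTop (𝓝 0) := by
    have h := tendsto_tsum_of_dominated_convergence (𝓕 := atTop) (f := fun x l => p l x)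
      (g := fun _ => 0) hs₀ (fun l => tendsto_prod_div_add_atTop l)
      ((eventually_ge_atTop lam₀).mono fun x hx l => norm_le l x hx)
    simpa using h
  have one_lt : 1 < ∑' l, p l lam₀ := by
    rwa [rho_eq le_rfl, ENNReal.one_lt_ofReal] at h₁
  obtain ⟨b, hb, hb₀⟩ :=
    ((lim.eventually_lt_const one_pos).and (eventually_ge_atTop lam₀)).exists
  obtain ⟨x, hx, hx₁⟩ := intermediate_value_Icc' hb₀ (cont.mono Icc_subset_Ici_self)
    ⟨hb.le, one_lt.le⟩
  refine ⟨x, ⟨hx.1, by rw [rho_eq hx.1, ENNReal.ofReal_eq_one]; exact hx₁⟩, ?_⟩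
  rintro y ⟨hy, hy₁⟩
  rw [rho_eq hy, ENNReal.ofReal_eq_one] at hy₁
  exact anti.injOn hy hx.1 (hy₁.trans hx₁.symm)
end
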